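/- For all real a with a ≥ 1, ∫₀¹ K(2√(x(1-x))) / √(1 - 2(2x-1)a + a²) dx = (1/a)[K(√((1-√(1+a^{-2}))/2))]². -/

import Mathlib

open MeasureTheory Real Filter

/-- Pochhammer symbol `(x)_n`. -/
noncomputable def poch (x : ℝ) (n : ℕ) : ℝ := ∏ i ∈ Finset.range n, (x + i)

/-- Complete elliptic integral of the first kind. -/
noncomputable def K (k : ℝ) : ℝ :=
  ∫ θ in Set.Ioo 0 (Real.pi / 2), 1 / Real.sqrt (1 - k ^ 2 * Real.sin θ ^ 2)

/-- `K` as a function of the squared modulus, via the hypergeometric series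
`K(k) = (π/2) ₂F₁(1/2,1/2;1;k²)`. -/
noncomputable def Ksq (m : ℝ) : ℝ :=
  (Real.pi / 2) * ∑' n : ℕ, poch (1/2) n ^ 2 / poch 1 n ^ 2 * m ^ n

/-- Legendre polynomial `P_n(x)`. -/
noncomputable def P (n : ℕ) (x : ℝ) : ℝ :=
  (1 / 2 ^ n) * ∑ k ∈ Finset.range (n + 1), (n.choose k : ℝ) ^ 2 * (x - 1) ^ (n - k) * (x + 1) ^ k

/-- The coefficients `(1/2)_n / n!` of `(1 - x)^(-1/2)`. -/
noncomputable def halfCoeff (n : ℕ) : ℝ := poch (1 / 2) n / poch 1 n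

theorem halfCoeff_zero : halfCoeff 0 = 1 := by simp [halfCoeff, poch]

theorem poch_one_pos (n : ℕ) : 0 < poch 1 n :=
  Finset.prod_pos fun i _ => by positivity

theorem halfCoeff_pos (n : ℕ) : 0 < halfCoeff n :=
  div_pos (Finset.prod_pos fun i _ => by positivity) (poch_one_pos n)

theorem halfCoeff_succ (n : ℕ) :
    2 * ((n : ℝ) + 1) * halfCoeff (n + 1) = (2 * n + 1) * halfCoeff n := by
  have h1 := (poch_one_pos n).ne'
  have h2 : (1 : ℝ) + n ≠ 0 := by positivity
  have e1 : poch 1 (n + 1) = poch 1 n * (1 + n) := Finset.prod_range_succ _ _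
  have e2 : poch (1 / 2) (n + 1) = poch (1 / 2) n * (1 / 2 + n) := Finset.prod_range_succ _ _
  rw [halfCoeff, halfCoeff, e1, e2]
  field_simp
  ring

theorem halfCoeff_sq_le (n : ℕ) : halfCoeff n ^ 2 ≤ 1 / (2 * n + 1) := by
  induction n with
  | zero => simp [halfCoeff_zero]
  | succ n ih =>
    have h : halfCoeff (n + 1) = (2 * n + 1) / (2 * (n + 1)) * halfCoeff n := by
      have := halfCoeff_succ n
      field_simp
      linarith
    rw [h, mul_pow]
    calc _ ≤ ((2 * (n : ℝ) + 1) / (2 * (n + 1))) ^ 2 * (1 / (2 * n + 1)) := by gcongr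
      _ ≤ _ := by
        push_cast
        rw [div_pow, div_mul_div_comm, div_le_div_iff₀ (by positivity) (by positivity)]
        nlinarith [(Nat.cast_nonneg n : (0 : ℝ) ≤ n)]

theorem halfCoeff_le_one (n : ℕ) : halfCoeff n ≤ 1 := by
  have h1 := halfCoeff_sq_le n
  have h2 : 1 / (2 * (n : ℝ) + 1) ≤ 1 := by
    rw [div_le_one (by positivity)]
    linarith [(Nat.cast_nonneg n : (0 : ℝ) ≤ n)]
  nlinarith [halfCoeff_pos n]

theorem summable_halfCoeff_cube : Summable fun n => halfCoeff n ^ 3 := by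
  have hs : Summable fun n : ℕ => 1 / ((n : ℝ) + 1) ^ (3 / 2 : ℝ) := by
    have := (summable_nat_add_iff 1).2
      (Real.summable_one_div_nat_rpow.2 (by norm_num : (1 : ℝ) < 3 / 2))
    simpa using this
  refine Summable.of_nonneg_of_le (fun n => (pow_pos (halfCoeff_pos n) 3).le) (fun n => ?_) hs
  have hn : (0 : ℝ) ≤ n := n.cast_nonneg
  have h1 : halfCoeff n ^ 2 ≤ 1 / ((n : ℝ) + 1) :=
    (halfCoeff_sq_le n).trans (one_div_le_one_div_of_le (by positivity) (by linarith))
  calc halfCoeff n ^ 3 = (halfCoeff n ^ 2) ^ (3 / 2 : ℝ) := by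
        rw [← Real.rpow_natCast, ← Real.rpow_natCast, ← Real.rpow_mul (halfCoeff_pos n).le]
        norm_num
    _ ≤ (1 / ((n : ℝ) + 1)) ^ (3 / 2 : ℝ) := by gcongr
    _ = _ := by rw [Real.div_rpow (by positivity) (by positivity), Real.one_rpow]

section Clausen

open PowerSeries

/-- The formal power series of `₂F₁(1/2,1/2;1;X)`. -/
noncomputable def ellipticSeries : PowerSeries ℝ := PowerSeries.mk fun n => halfCoeff n ^ 2

/-- The symmetric square of the hypergeometric operator annihilating `₂F₁(1/2,1/2;1;X)`. -/
noncomputable def clausenOp (h : PowerSeries ℝ) : PowerSeries ℝ :=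
  (X * (1 - X)) ^ 2 * d⁄dX ℝ (d⁄dX ℝ (d⁄dX ℝ h)) +
    3 * (X * (1 - X)) * (1 - 2 * X) * d⁄dX ℝ (d⁄dX ℝ h) +
    ((1 - 2 * X) ^ 2 - 3 * (X * (1 - X))) * d⁄dX ℝ h - C (1 / 2 : ℝ) * (1 - 2 * X) * h

theorem clausenOp_add (f g : PowerSeries ℝ) :
    clausenOp (f + g) = clausenOp f + clausenOp g := by
  simp only [clausenOp, map_add]
  ring

theorem clausenOp_C_mul (c : ℝ) (g : PowerSeries ℝ) :
    clausenOp (C c * g) = C c * clausenOp g := by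
  have h (f : PowerSeries ℝ) : d⁄dX ℝ (C c * f) = C c * d⁄dX ℝ f := by
    rw [← smul_eq_C_mul, ← smul_eq_C_mul, Derivation.map_smul]
  simp only [clausenOp, h]
  ring

theorem ellipticSeries_ode :
    X * (1 - X) * d⁄dX ℝ (d⁄dX ℝ ellipticSeries) + (1 - 2 * X) * d⁄dX ℝ ellipticSeries =
      C (1 / 4 : ℝ) * ellipticSeries := by
  have e : X * (1 - X) * d⁄dX ℝ (d⁄dX ℝ ellipticSeries) + (1 - 2 * X) * d⁄dX ℝ ellipticSeries =
      X * d⁄dX ℝ (d⁄dX ℝ ellipticSeries) - X * (X * d⁄dX ℝ (d⁄dX ℝ ellipticSeries))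
      + d⁄dX ℝ ellipticSeries - C (2 : ℝ) * (X * d⁄dX ℝ ellipticSeries) := by
    rw [show (C (2 : ℝ) : PowerSeries ℝ) = 2 from map_ofNat C 2]
    ring
  rw [e]
  ext n
  have h0 := halfCoeff_succ n
  have h1 : 4 * ((n : ℝ) + 1) ^ 2 * halfCoeff (n + 1) ^ 2 =
      (2 * n + 1) ^ 2 * halfCoeff n ^ 2 := by
    rw [← mul_pow, ← h0]; ring
  rcases n with _ | n
  · simp [ellipticSeries] at *
    rw [← coeff_zero_eq_constantCoeff_apply, coeff_derivative]
    simp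
    linarith
  rcases n with _ | n
  · simp [coeff_derivative, coeff_succ_X_mul, ellipticSeries] at *
    linarith
  · simp [coeff_derivative, coeff_succ_X_mul, ellipticSeries] at *
    linarith

theorem clausenOp_ellipticSeries_sq : clausenOp (ellipticSeries ^ 2) = 0 := by
  have h := ellipticSeries_ode
  have h' := congrArg (d⁄dX ℝ) h
  have h2 : d⁄dX ℝ (2 : PowerSeries ℝ) = 0 := by
    simpa using (d⁄dX ℝ).map_natCast 2
  have hC (c : ℝ) : d⁄dX ℝ (C c) = 0 := by simp
  have hX : d⁄dX ℝ (X : PowerSeries ℝ) = 1 := by simp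
  have h4 : (C (1 / 2 : ℝ) : PowerSeries ℝ) = 2 * C (1 / 4 : ℝ) := by
    rw [← map_ofNat C 2, ← map_mul]; norm_num
  have h5 : 4 * (C (1 / 4 : ℝ) : PowerSeries ℝ) = 1 := by
    rw [← map_ofNat C 4, ← map_mul]; norm_num
  simp only [map_add, map_sub, Derivation.leibniz, smul_eq_mul, h2, hC, hX,
    Derivation.map_one_eq_zero] at h'
  rw [clausenOp, h4]
  simp only [pow_two, Derivation.leibniz, smul_eq_mul, map_add]
  generalize ellipticSeries = y at *
  generalize d⁄dX ℝ (d⁄dX ℝ (d⁄dX ℝ y)) = y3 at *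
  generalize d⁄dX ℝ (d⁄dX ℝ y) = y2 at *
  generalize d⁄dX ℝ y = y1 at *
  generalize (C (1 / 4 : ℝ) : PowerSeries ℝ) = q at *
  linear_combination (2 * y * X * (1 - X)) * h' + (6 * X * (1 - X) * y1 + 2 * y * (1 - 2 * X)) * h +
    (2 * y * y1 * X * (1 - X)) * h5

theorem derivative_mul_one_sub_pow (n : ℕ) :
    d⁄dX ℝ ((X * (1 - X)) ^ (n + 1) : PowerSeries ℝ) =
      ((n : PowerSeries ℝ) + 1) * ((X * (1 - X)) ^ n * (1 - 2 * X)) := by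
  have hX : d⁄dX ℝ (X : PowerSeries ℝ) = 1 := by simp
  simp only [Derivation.leibniz_pow, Derivation.leibniz, map_sub, hX, Derivation.map_one_eq_zero,
    smul_eq_mul, nsmul_eq_mul, Nat.add_sub_cancel]
  push_cast
  ring

theorem clausenOp_pow (n : ℕ) :
    clausenOp ((X * (1 - X)) ^ (n + 1)) = (1 - 2 * X) *
      (((n : PowerSeries ℝ) + 1) ^ 3 * (X * (1 - X)) ^ n
        - C (1 / 2 : ℝ) * (2 * ((n : PowerSeries ℝ) + 1) + 1) ^ 3 * (X * (1 - X)) ^ (n + 1)) := by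
  have hX : d⁄dX ℝ (X : PowerSeries ℝ) = 1 := by simp
  have h2 : d⁄dX ℝ (2 : PowerSeries ℝ) = 0 := by
    simpa using (d⁄dX ℝ).map_natCast 2
  have hn (n : ℕ) : d⁄dX ℝ (n : PowerSeries ℝ) = 0 := (d⁄dX ℝ).map_natCast n
  have h4 : 2 * (C (1 / 2 : ℝ) : PowerSeries ℝ) = 1 := by
    rw [← map_ofNat C 2, ← map_mul]; norm_num
  rw [clausenOp]
  rcases n with _ | _ | n <;>
  simp only [derivative_mul_one_sub_pow, Derivation.leibniz, smul_eq_mul, map_add, map_sub, h2, hX,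
    hn, Derivation.map_one_eq_zero, pow_zero, Nat.cast_zero, Nat.cast_one, Nat.cast_add, zero_add,
    map_zero]
  · linear_combination ((1 - 2 * X) * (X * (1 - X)) * 13) * h4
  · linear_combination ((1 - 2 * X) * (X * (1 - X)) ^ 2 * 62) * h4
  · linear_combination ((1 - 2 * X) * (X * (1 - X)) ^ (n + 3) *
      (4 * ((n : PowerSeries ℝ) + 3) ^ 3 + 6 * (n + 3) ^ 2 + 3 * (n + 3))) * h4

theorem coeff_clausenOp (h : PowerSeries ℝ) (n : ℕ) :
    coeff n (clausenOp h) = ((n : ℝ) + 1) ^ 3 * coeff (n + 1) h -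
      (2 * n ^ 3 + 3 * n ^ 2 + 2 * n + 1 / 2) * coeff n h + n ^ 3 * coeff (n - 1) h := by
  have e : clausenOp h = X * (X * d⁄dX ℝ (d⁄dX ℝ (d⁄dX ℝ h)))
      - C (2 : ℝ) * (X * (X * (X * d⁄dX ℝ (d⁄dX ℝ (d⁄dX ℝ h)))))
      + X * (X * (X * (X * d⁄dX ℝ (d⁄dX ℝ (d⁄dX ℝ h)))))
      + C (3 : ℝ) * (X * d⁄dX ℝ (d⁄dX ℝ h)) - C (9 : ℝ) * (X * (X * d⁄dX ℝ (d⁄dX ℝ h)))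
      + C (6 : ℝ) * (X * (X * (X * d⁄dX ℝ (d⁄dX ℝ h))))
      + d⁄dX ℝ h - C (7 : ℝ) * (X * d⁄dX ℝ h) + C (7 : ℝ) * (X * (X * d⁄dX ℝ h))
      - C (1 / 2 : ℝ) * h + C (1 / 2 : ℝ) * (C (2 : ℝ) * (X * h)) := by
    rw [clausenOp, map_ofNat C 2, map_ofNat C 3, map_ofNat C 9, map_ofNat C 6, map_ofNat C 7]
    ring
  rw [e]
  rcases n with _ | _ | _ | _ | n
  · simp
    rw [← coeff_zero_eq_constantCoeff_apply, coeff_derivative]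
    simp
  all_goals
    simp [coeff_derivative, coeff_succ_X_mul, coeff_zero_X_mul, -coeff_zero_eq_constantCoeff]
    ring_nf

theorem coeff_eq_zero_of_clausenOp {h : PowerSeries ℝ} {M : ℕ} (h0 : coeff 0 h = 0)
    (hM : X ^ M ∣ clausenOp h) (n : ℕ) (hn : n ≤ M) : coeff n h = 0 := by
  induction n using Nat.strong_induction_on with
  | _ n ih =>
    rcases n with _ | n
    · exact h0
    have h1 := coeff_clausenOp h n
    rw [X_pow_dvd_iff.1 hM n (by omega), ih n (by omega) (by omega),
      ih (n - 1) (by omega) (by omega)] at h1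
    have h2 : ((n : ℝ) + 1) ^ 3 ≠ 0 := by positivity
    simpa [h2] using h1

/-- The partial sums of `₃F₂(1/2,1/2,1/2;1,1;4X(1-X))`. -/
noncomputable def clausenSum (M : ℕ) : PowerSeries ℝ :=
  ∑ n ∈ Finset.range (M + 1), C (halfCoeff n ^ 3 * 4 ^ n) * (X * (1 - X)) ^ n

theorem clausenOp_clausenSum (M : ℕ) :
    clausenOp (clausenSum M) =
      -(C (halfCoeff M ^ 3 * 4 ^ M * ((2 * M + 1) ^ 3 / 2)) * (1 - 2 * X) * (X * (1 - X)) ^ M) := by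
  induction M with
  | zero => simp [clausenSum, clausenOp, halfCoeff_zero]
  | succ M ih =>
    have h1 : 4 * (halfCoeff (M + 1) ^ 3 * 4 ^ M) * ((M : ℝ) + 1) ^ 3 =
        halfCoeff M ^ 3 * 4 ^ M * ((2 * M + 1) ^ 3 / 2) := by
      have := congrArg (· ^ 3) (halfCoeff_succ M)
      simp only [mul_pow] at this
      linear_combination 4 ^ M / 2 * this
    have h2 (k : ℕ) : C ((k : ℝ)) = (k : PowerSeries ℝ) := map_natCast C k
    rw [clausenSum, Finset.sum_range_succ, ← clausenSum, clausenOp_add, ih, clausenOp_C_mul,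
      clausenOp_pow, ← h1]
    push_cast
    simp only [map_mul, map_add, map_pow, h2, map_one, map_ofNat, div_eq_mul_inv, one_mul]
    ring

theorem coeff_ellipticSeries_sq {n M : ℕ} (hn : n ≤ M) :
    coeff n (ellipticSeries ^ 2) = coeff n (clausenSum M) := by
  rw [← sub_eq_zero, ← map_sub]
  have e : ellipticSeries ^ 2 - clausenSum M = ellipticSeries ^ 2 + C (-1 : ℝ) * clausenSum M := by
    simp [sub_eq_add_neg]
  refine coeff_eq_zero_of_clausenOp (M := M) ?_ ?_ n hn
  · simp [ellipticSeries, clausenSum, Finset.sum_range_succ', halfCoeff_zero]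
  · rw [e, clausenOp_add, clausenOp_C_mul, clausenOp_ellipticSeries_sq, clausenOp_clausenSum,
      mul_pow]
    exact ⟨C (halfCoeff M ^ 3 * 4 ^ M * ((2 * M + 1) ^ 3 / 2)) * (1 - 2 * X) * (1 - X) ^ M, by
      simp; ring⟩

end Clausen

theorem tsum_coeff_mul_tsum_coeff (f g : PowerSeries ℝ) (r : ℝ)
    (hf : Summable fun n => ‖PowerSeries.coeff n f * r ^ n‖)
    (hg : Summable fun n => ‖PowerSeries.coeff n g * r ^ n‖) :
    (∑' n, PowerSeries.coeff n f * r ^ n) * (∑' n, PowerSeries.coeff n g * r ^ n) =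
      ∑' n, PowerSeries.coeff n (f * g) * r ^ n := by
  rw [tsum_mul_tsum_eq_tsum_sum_antidiagonal_of_summable_norm hf hg]
  refine tsum_congr fun n => ?_
  rw [PowerSeries.coeff_mul, Finset.sum_mul]
  refine Finset.sum_congr rfl fun p hp => ?_
  rw [← Finset.HasAntidiagonal.mem_antidiagonal.1 hp, pow_add]
  ring

theorem summable_coeff_mul {f g : PowerSeries ℝ} {r : ℝ}
    (hf : Summable fun n => ‖PowerSeries.coeff n f * r ^ n‖)
    (hg : Summable fun n => ‖PowerSeries.coeff n g * r ^ n‖) :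
    Summable fun n => ‖PowerSeries.coeff n (f * g) * r ^ n‖ := by
  refine (summable_norm_sum_mul_antidiagonal_of_summable_norm hf hg).congr fun n => ?_
  rw [PowerSeries.coeff_mul, Finset.sum_mul]
  congr 1
  refine Finset.sum_congr rfl fun p hp => ?_
  rw [← Finset.HasAntidiagonal.mem_antidiagonal.1 hp, pow_add]
  ring

theorem coeff_one_sub_X_pow (n k : ℕ) :
    PowerSeries.coeff k ((1 - PowerSeries.X : PowerSeries ℝ) ^ n) = (-1) ^ k * n.choose k := by
  have h (i : ℕ) : (-PowerSeries.X : PowerSeries ℝ) ^ i * 1 ^ (n - i) * (n.choose i : PowerSeries ℝ)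
      = PowerSeries.C ((-1) ^ i * (n.choose i : ℝ)) * PowerSeries.X ^ i := by
    rw [neg_pow]
    simp
    ring
  rw [sub_eq_add_neg, add_comm, add_pow, map_sum]
  simp_rw [h, PowerSeries.coeff_C_mul, PowerSeries.coeff_X_pow]
  simp only [mul_ite, mul_one, mul_zero, Finset.sum_ite_eq, Finset.mem_range]
  split_ifs with hk
  · rfl
  · rw [Nat.choose_eq_zero_of_lt (by omega)]
    simp

theorem hasSum_choose_mul_pow (n : ℕ) (x : ℝ) :
    HasSum (fun k => (n.choose k : ℝ) * x ^ k) ((1 + x) ^ n) := by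
  have h : (1 + x) ^ n = ∑ k ∈ Finset.range (n + 1), (n.choose k : ℝ) * x ^ k := by
    rw [add_comm, add_pow]
    exact Finset.sum_congr rfl fun k _ => by ring
  rw [h]
  refine hasSum_sum_of_ne_finset_zero fun k hk => ?_
  rw [Nat.choose_eq_zero_of_lt (by simpa using hk)]
  simp

theorem summable_ellipticSeries {m : ℝ} (hm : |m| < 1) :
    Summable fun n => ‖PowerSeries.coeff n ellipticSeries * m ^ n‖ := by
  refine Summable.of_nonneg_of_le (fun n => norm_nonneg _) (fun n => ?_)
    (summable_geometric_of_lt_one (abs_nonneg m) hm)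
  rw [ellipticSeries, PowerSeries.coeff_mk, norm_mul, norm_pow, norm_pow, Real.norm_eq_abs,
    Real.norm_eq_abs, abs_of_pos (halfCoeff_pos n)]
  exact mul_le_of_le_one_left (by positivity) (pow_le_one₀ (halfCoeff_pos n).le (halfCoeff_le_one n))

theorem tsum_ellipticSeries_sq {m : ℝ} (hm : 4 * (|m| * (1 + |m|)) ≤ 1) :
    ∑' n, PowerSeries.coeff n (ellipticSeries ^ 2) * m ^ n =
      ∑' n, halfCoeff n ^ 3 * (4 * (m * (1 - m))) ^ n := by
  set F : ℕ × ℕ → ℝ := fun p =>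
    halfCoeff p.1 ^ 3 * (4 * m) ^ p.1 * ((p.1.choose p.2 : ℝ) * (-m) ^ p.2) with hF
  have hrow (n : ℕ) : HasSum (fun k => F (n, k)) (halfCoeff n ^ 3 * (4 * (m * (1 - m))) ^ n) := by
    have h := (hasSum_choose_mul_pow n (-m)).mul_left (halfCoeff n ^ 3 * (4 * m) ^ n)
    rwa [mul_assoc, ← mul_pow, ← sub_eq_add_neg, mul_assoc 4] at h
  have hrow' (n : ℕ) : HasSum (fun k => ‖F (n, k)‖)
      (halfCoeff n ^ 3 * (4 * (|m| * (1 + |m|))) ^ n) := by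
    have h := (hasSum_choose_mul_pow n |m|).mul_left (halfCoeff n ^ 3 * (4 * |m|) ^ n)
    rw [mul_assoc, ← mul_pow, mul_assoc 4] at h
    refine h.congr_fun fun k => ?_
    simp [hF, abs_of_pos (halfCoeff_pos n)]
  have hs : Summable F := by
    refine Summable.of_norm ((summable_prod_of_nonneg fun p => norm_nonneg _).2
      ⟨fun n => (hrow' n).summable, ?_⟩)
    simp_rw [fun n => (hrow' n).tsum_eq]
    refine Summable.of_nonneg_of_le (fun n => ?_) (fun n => ?_) summable_halfCoeff_cube
    · have := halfCoeff_pos n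
      positivity
    · exact mul_le_of_le_one_right (pow_pos (halfCoeff_pos n) 3).le
        (pow_le_one₀ (by positivity) hm)
  have h1 : ∑' p, F p = ∑' n, halfCoeff n ^ 3 * (4 * (m * (1 - m))) ^ n := by
    rw [hs.tsum_prod]
    exact tsum_congr fun n => (hrow n).tsum_eq
  have h2 := (Finset.HasAntidiagonal.sigmaAntidiagonalEquivProd.hasSum_iff.2 hs.hasSum).sigma
    (fun N => hasSum_fintype _)
  rw [← h1, ← h2.tsum_eq]
  refine tsum_congr fun N => ?_
  rw [coeff_ellipticSeries_sq le_rfl, clausenSum, map_sum, Finset.sum_mul]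
  rw [Finset.univ_eq_attach]
  refine Eq.trans ?_ (Finset.sum_attach _ F).symm
  rw [Finset.Nat.sum_antidiagonal_eq_sum_range_succ_mk]
  refine Finset.sum_congr rfl fun n hn => ?_
  obtain ⟨k, rfl⟩ := Nat.exists_eq_add_of_le (Nat.lt_succ_iff.1 (Finset.mem_range.1 hn))
  rw [PowerSeries.coeff_C_mul, mul_pow, add_comm n k, PowerSeries.coeff_X_pow_mul,
    coeff_one_sub_X_pow, hF]
  simp only [Nat.add_sub_cancel]
  rw [neg_pow m, mul_pow, pow_add]
  ring

theorem Ksq_sq {m : ℝ} (hm : 4 * (|m| * (1 + |m|)) ≤ 1) :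
    Ksq m ^ 2 = π ^ 2 / 4 * ∑' n, halfCoeff n ^ 3 * (4 * (m * (1 - m))) ^ n := by
  have h1 : |m| < 1 := by nlinarith [abs_nonneg m]
  have h2 := tsum_coeff_mul_tsum_coeff _ _ m (summable_ellipticSeries h1)
    (summable_ellipticSeries h1)
  rw [← pow_two, ← pow_two, tsum_ellipticSeries_sq hm] at h2
  rw [← h2, Ksq, mul_pow, div_pow]
  simp only [ellipticSeries, PowerSeries.coeff_mk, halfCoeff, div_pow]
  norm_num

theorem Ksq_sq_eq_tsum {r : ℝ} (hr : r ^ 2 ≤ 1) :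
    Ksq ((1 - √(1 + r ^ 2)) / 2) ^ 2 = π ^ 2 / 4 * ∑' n, halfCoeff n ^ 3 * (-r ^ 2) ^ n := by
  have h1 : 1 ≤ √(1 + r ^ 2) := Real.one_le_sqrt.2 (by nlinarith [sq_nonneg r])
  have h2 : √(1 + r ^ 2) ^ 2 = 1 + r ^ 2 := Real.sq_sqrt (by positivity)
  rw [Ksq_sq]
  · congr! 5
    linear_combination -h2
  · rw [abs_of_nonpos (by linarith)]
    linarith

section Legendre

open Polynomial

/-- The Legendre polynomials, through the Bonnet recursion. -/
noncomputable def legendrePoly : ℕ → ℝ[X]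
  | 0 => 1
  | 1 => X
  | n + 2 => C (1 / ((n : ℝ) + 2)) *
      ((2 * (n : ℝ[X]) + 3) * X * legendrePoly (n + 1) - ((n : ℝ[X]) + 1) * legendrePoly n)

theorem C_two_real : (C (2 : ℝ) : ℝ[X]) = 2 := map_ofNat C 2

theorem C_three_real : (C (3 : ℝ) : ℝ[X]) = 3 := map_ofNat C 3

theorem legendrePoly_bonnet (n : ℕ) :
    ((n : ℝ[X]) + 2) * legendrePoly (n + 2) =
      (2 * (n : ℝ[X]) + 3) * X * legendrePoly (n + 1) - ((n : ℝ[X]) + 1) * legendrePoly n := by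
  have h : ((n : ℝ[X]) + 2) * C (1 / ((n : ℝ) + 2)) = 1 := by
    have h0 : ((n : ℝ[X]) + 2) = C ((n : ℝ) + 2) := by simp [C_two_real]
    rw [h0, ← C_mul, mul_one_div_cancel (by positivity), C_1]
  rw [legendrePoly, ← mul_assoc, h, one_mul]

theorem derivative_legendrePoly (n : ℕ) :
    (1 - X ^ 2) * derivative (legendrePoly (n + 1)) =
        ((n : ℝ[X]) + 1) * (legendrePoly n - X * legendrePoly (n + 1)) ∧
      (1 - X ^ 2) * derivative (legendrePoly n) =
        ((n : ℝ[X]) + 1) * (X * legendrePoly n - legendrePoly (n + 1)) := by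
  induction n with
  | zero => simp [legendrePoly]; ring
  | succ n ih =>
    obtain ⟨hA, hB⟩ := ih
    have hr := legendrePoly_bonnet n
    have hn : ((n : ℝ[X]) + 2) ≠ 0 := by
      have : ((n + 2 : ℕ) : ℝ[X]) ≠ 0 := Nat.cast_ne_zero.2 (by omega)
      simpa using this
    have hr' := congrArg derivative hr
    simp only [derivative_mul, derivative_sub, derivative_add, derivative_natCast,
      derivative_ofNat, derivative_one, derivative_X] at hr'
    push_cast
    constructor
    · refine mul_left_cancel₀ hn ?_
      linear_combination (1 - X ^ 2) * hr' + (2 * (n : ℝ[X]) + 3) * X * hA - ((n : ℝ[X]) + 1) * hB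
        + ((n : ℝ[X]) + 2) * X * hr
    · linear_combination hA + hr

theorem legendrePoly_ode (n : ℕ) :
    X * derivative ((1 - X ^ 2) * derivative (legendrePoly (n + 1))) +
        (1 - X ^ 2) * derivative (legendrePoly (n + 1)) - X * legendrePoly (n + 1) =
      ((n : ℝ[X]) + 1) * legendrePoly n - ((n : ℝ[X]) + 2) ^ 2 * (X * legendrePoly (n + 1)) := by
  obtain ⟨hA, hB⟩ := derivative_legendrePoly n
  have hX : (1 - X ^ 2 : ℝ[X]) ≠ 0 := fun h => by
    simpa using congrArg (eval 0) h
  have h : derivative (legendrePoly n) =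
      X * derivative (legendrePoly (n + 1)) - ((n : ℝ[X]) + 1) * legendrePoly (n + 1) := by
    refine mul_left_cancel₀ hX ?_
    linear_combination hB - X * hA
  rw [hA]
  simp only [derivative_mul, derivative_sub, derivative_add, derivative_natCast, derivative_one,
    derivative_X]
  linear_combination ((n : ℝ[X]) + 1) * X * h

theorem map_ode_eq_zero {L : ℝ[X] →ₗ[ℝ] ℝ} (h1 : L X = 0)
    (h2 : ∀ n : ℕ, ((n : ℝ) + 2) ^ 2 * L (X ^ (n + 2)) = ((n : ℝ) + 1) ^ 2 * L (X ^ n)) (f : ℝ[X]) :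
    L (X * derivative ((1 - X ^ 2) * derivative f) + (1 - X ^ 2) * derivative f - X * f) = 0 := by
  induction f using Polynomial.induction_on' with
  | add p q hp hq =>
    rw [← add_zero (0 : ℝ)]
    nth_rw 1 [← hp]
    rw [← hq, ← map_add]
    congr 1
    simp only [derivative_add, mul_add]
    ring
  | monomial n a =>
    rw [← C_mul_X_pow_eq_monomial]
    rcases n with _ | n
    · have : X * derivative ((1 - X ^ 2) * derivative (C a * X ^ 0)) +
          (1 - X ^ 2) * derivative (C a * X ^ 0) - X * (C a * X ^ 0) = (-a) • X := by
        simp [smul_eq_C_mul]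
      rw [this, map_smul, h1, smul_zero]
    · have : X * derivative ((1 - X ^ 2) * derivative (C a * X ^ (n + 1))) +
          (1 - X ^ 2) * derivative (C a * X ^ (n + 1)) - X * (C a * X ^ (n + 1)) =
          (a * ((n : ℝ) + 1) ^ 2) • X ^ n - (a * ((n : ℝ) + 2) ^ 2) • X ^ (n + 2) := by
        rcases n with _ | n <;>
        · simp [smul_eq_C_mul, C_two_real]; ring
      rw [this, map_sub, map_smul, map_smul, smul_eq_mul, smul_eq_mul]
      linear_combination (-a) * h2 n

theorem map_legendrePoly {L : ℝ[X] →ₗ[ℝ] ℝ} (h1 : L X = 0)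
    (h2 : ∀ n : ℕ, ((n : ℝ) + 2) ^ 2 * L (X ^ (n + 2)) = ((n : ℝ) + 1) ^ 2 * L (X ^ n)) (n : ℕ) :
    ((n : ℝ) + 2) ^ 3 * L (legendrePoly (n + 2)) = -((n : ℝ) + 1) ^ 3 * L (legendrePoly n) := by
  have h := map_ode_eq_zero h1 h2 (legendrePoly (n + 1))
  have e1 : ((n : ℝ[X]) + 1) * legendrePoly n - ((n : ℝ[X]) + 2) ^ 2 * (X * legendrePoly (n + 1))
      = ((n : ℝ) + 1) • legendrePoly n - (((n : ℝ) + 2) ^ 2) • (X * legendrePoly (n + 1)) := by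
    simp [smul_eq_C_mul, C_two_real]
  have e2 : ((n : ℝ) + 2) • legendrePoly (n + 2) =
      (2 * (n : ℝ) + 3) • (X * legendrePoly (n + 1)) - ((n : ℝ) + 1) • legendrePoly n := by
    have := legendrePoly_bonnet n
    simpa [smul_eq_C_mul, C_two_real, C_three_real, mul_assoc] using this
  rw [legendrePoly_ode, e1] at h
  replace e2 := congrArg L e2
  simp only [map_sub, map_smul, smul_eq_mul] at h e2
  linear_combination ((n : ℝ) + 2) ^ 2 * e2 - (2 * (n : ℝ) + 3) * h

theorem map_legendrePoly_odd {L : ℝ[X] →ₗ[ℝ] ℝ} (h1 : L X = 0)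
    (h2 : ∀ n : ℕ, ((n : ℝ) + 2) ^ 2 * L (X ^ (n + 2)) = ((n : ℝ) + 1) ^ 2 * L (X ^ n)) (n : ℕ) :
    L (legendrePoly (2 * n + 1)) = 0 := by
  induction n with
  | zero => simpa [legendrePoly] using h1
  | succ n ih =>
    have h := map_legendrePoly h1 h2 (2 * n + 1)
    rw [ih, mul_zero] at h
    exact (mul_eq_zero.1 h).resolve_left (by positivity)

theorem map_legendrePoly_even {L : ℝ[X] →ₗ[ℝ] ℝ} (h1 : L X = 0)
    (h2 : ∀ n : ℕ, ((n : ℝ) + 2) ^ 2 * L (X ^ (n + 2)) = ((n : ℝ) + 1) ^ 2 * L (X ^ n)) (n : ℕ) :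
    L (legendrePoly (2 * n)) = (-1) ^ n * halfCoeff n ^ 3 * L 1 := by
  induction n with
  | zero => simp [legendrePoly, halfCoeff_zero]
  | succ n ih =>
    have h := map_legendrePoly h1 h2 (2 * n)
    have hc := congrArg (· ^ 3) (halfCoeff_succ n)
    simp only [mul_pow] at hc
    rw [ih] at h
    have hn : (8 * ((n : ℝ) + 1) ^ 3) ≠ 0 := by positivity
    refine mul_left_cancel₀ hn ?_
    push_cast at h
    rw [show 2 * (n + 1) = 2 * n + 2 by ring, pow_succ]
    linear_combination h + (-1) ^ n * L 1 * hc

theorem legendrePoly_eval_bonnet (n : ℕ) (s : ℝ) :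
    ((n : ℝ) + 2) * (legendrePoly (n + 2)).eval s =
      (2 * n + 3) * s * (legendrePoly (n + 1)).eval s - (n + 1) * (legendrePoly n).eval s := by
  simpa using congrArg (eval s) (legendrePoly_bonnet n)

theorem legendrePoly_energy_le (s : ℝ) (n : ℕ) :
    ((legendrePoly (n + 1)).eval s - s * (legendrePoly n).eval s) ^ 2 +
      (1 - s ^ 2) * (legendrePoly n).eval s ^ 2 ≤ 1 - s ^ 2 := by
  induction n with
  | zero => simp [legendrePoly]
  | succ n ih =>
    refine le_trans ?_ ih
    have h : (legendrePoly (n + 2)).eval s - s * (legendrePoly (n + 1)).eval s =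
        ((n + 1) / (n + 2)) * (s * (legendrePoly (n + 1)).eval s - (legendrePoly n).eval s) := by
      have := legendrePoly_eval_bonnet n s
      field_simp
      linear_combination this
    have h1 : (((n : ℝ) + 1) / (n + 2)) ^ 2 ≤ 1 :=
      pow_le_one₀ (by positivity) (by rw [div_le_one (by positivity)]; linarith)
    rw [h, mul_pow]
    have := mul_le_mul_of_nonneg_right h1
      (sq_nonneg (s * (legendrePoly (n + 1)).eval s - (legendrePoly n).eval s))
    linarith

theorem abs_legendrePoly_le {s : ℝ} (hs : s ^ 2 < 1) (n : ℕ) :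
    |(legendrePoly n).eval s| ≤ 1 := by
  have h := legendrePoly_energy_le s n
  rw [← sq_le_one_iff_abs_le_one]
  have h0 : 0 < 1 - s ^ 2 := by linarith
  refine le_of_mul_le_mul_left ?_ h0
  linarith [sq_nonneg ((legendrePoly (n + 1)).eval s - s * (legendrePoly n).eval s)]

theorem legendrePoly_series_sq (s : ℝ) :
    (1 - PowerSeries.C (2 * s) * PowerSeries.X + PowerSeries.X ^ 2) *
      (PowerSeries.mk fun n => (legendrePoly n).eval s) ^ 2 = 1 := by
  set p : PowerSeries ℝ := PowerSeries.mk fun n => (legendrePoly n).eval s with hp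
  have h : PowerSeries.derivative ℝ p - PowerSeries.C (2 * s) *
      (PowerSeries.X * PowerSeries.derivative ℝ p) +
      PowerSeries.X * (PowerSeries.X * PowerSeries.derivative ℝ p) =
      PowerSeries.C s * p - PowerSeries.X * p := by
    ext n
    rcases n with _ | _ | n
    · simp [-map_mul, PowerSeries.coeff_derivative, hp, -PowerSeries.coeff_zero_eq_constantCoeff,
        PowerSeries.coeff_zero_X_mul, legendrePoly]
    · have := legendrePoly_eval_bonnet 0 s
      simp [-map_mul, PowerSeries.coeff_derivative, hp, -PowerSeries.coeff_zero_eq_constantCoeff,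
        PowerSeries.coeff_zero_X_mul, PowerSeries.coeff_succ_X_mul] at *
      linarith
    · have := legendrePoly_eval_bonnet (n + 1) s
      simp [-map_mul, PowerSeries.coeff_derivative, hp, PowerSeries.coeff_succ_X_mul] at *
      linarith
  have hX : PowerSeries.derivative ℝ (PowerSeries.X : PowerSeries ℝ) = 1 := by simp
  have hC (c : ℝ) : PowerSeries.derivative ℝ (PowerSeries.C c) = 0 := by simp
  have h2 : (PowerSeries.C (2 * s) : PowerSeries ℝ) = 2 * PowerSeries.C s := by
    rw [map_mul, map_ofNat]
  refine PowerSeries.derivative.ext ?_ ?_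
  · simp only [pow_two, Derivation.leibniz, smul_eq_mul, map_add, map_sub, hX, hC,
      Derivation.map_one_eq_zero]
    rw [h2] at h ⊢
    linear_combination 2 * p * h
  · simp [hp, legendrePoly]

theorem summable_legendrePoly {s r : ℝ} (hs : s ^ 2 < 1) (hr : |r| < 1) :
    Summable fun n => ‖(legendrePoly n).eval s * r ^ n‖ := by
  refine Summable.of_nonneg_of_le (fun n => norm_nonneg _) (fun n => ?_)
    (summable_geometric_of_lt_one (abs_nonneg r) hr)
  rw [norm_mul, norm_pow, Real.norm_eq_abs, Real.norm_eq_abs]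
  exact mul_le_of_le_one_left (by positivity) (abs_legendrePoly_le hs n)

theorem legendre_generating_sq {s r : ℝ} (hs : s ^ 2 < 1) (hr : |r| < 1) :
    (1 - 2 * s * r + r ^ 2) * (∑' n, (legendrePoly n).eval s * r ^ n) ^ 2 = 1 := by
  set p : PowerSeries ℝ := PowerSeries.mk fun n => (legendrePoly n).eval s with hp
  set q : PowerSeries ℝ := 1 - PowerSeries.C (2 * s) * PowerSeries.X + PowerSeries.X ^ 2 with hq
  have hsum : Summable fun n => ‖PowerSeries.coeff n p * r ^ n‖ := by
    simpa [hp] using summable_legendrePoly hs hr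
  have hq0 (n : ℕ) (hn : n ∉ Finset.range 3) : PowerSeries.coeff n q * r ^ n = 0 := by
    rcases n with _ | _ | _ | n
    · simp at hn
    · simp at hn
    · simp at hn
    · simp [hq, -map_mul, PowerSeries.coeff_one, PowerSeries.coeff_X_pow]
  have hqs : Summable fun n => ‖PowerSeries.coeff n q * r ^ n‖ :=
    summable_of_ne_finset_zero (s := Finset.range 3) fun n hn => by rw [hq0 n hn, norm_zero]
  have hqv : ∑' n, PowerSeries.coeff n q * r ^ n = 1 - 2 * s * r + r ^ 2 := by
    rw [tsum_eq_sum hq0]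
    simp [Finset.sum_range_succ, hq, -map_mul, PowerSeries.coeff_one, PowerSeries.coeff_X_pow,
      PowerSeries.coeff_X]
    ring
  have h1 := tsum_coeff_mul_tsum_coeff p p r hsum hsum
  have h2 := tsum_coeff_mul_tsum_coeff q (p * p) r hqs (summable_coeff_mul hsum hsum)
  rw [← h1, ← pow_two, ← pow_two, legendrePoly_series_sq, hqv] at h2
  have h3 : ∑' n, PowerSeries.coeff n (1 : PowerSeries ℝ) * r ^ n = 1 := by
    rw [tsum_eq_single 0 fun n hn => by simp [PowerSeries.coeff_one, hn]]
    simp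
  rw [h3] at h2
  simpa [hp] using h2

theorem legendre_generating {s r : ℝ} (hs : s ^ 2 < 1) (h0 : 0 ≤ r) (hr : r < 1) :
    HasSum (fun n => (legendrePoly n).eval s * r ^ n) (1 / √(1 - 2 * s * r + r ^ 2)) := by
  have habs {x : ℝ} (hx : x ∈ Set.Icc 0 r) : |x| < 1 := by
    rw [abs_of_nonneg hx.1]
    exact hx.2.trans_lt hr
  have hrr : r ∈ Set.Icc 0 r := ⟨h0, le_rfl⟩
  have hsq {x : ℝ} (hx : x ∈ Set.Icc 0 r) := legendre_generating_sq hs (habs hx)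
  have hcont : ContinuousOn (fun x : ℝ => ∑' n, (legendrePoly n).eval s * x ^ n) (Set.Icc 0 r) := by
    refine continuousOn_tsum (u := fun n => r ^ n) (fun n => by fun_prop)
      (summable_geometric_of_lt_one h0 hr) fun n x hx => ?_
    rw [norm_mul, norm_pow, Real.norm_eq_abs, Real.norm_eq_abs, abs_of_nonneg hx.1]
    calc _ ≤ 1 * r ^ n := by
          have := hx.1
          have := hx.2
          gcongr
          exact abs_legendrePoly_le hs n
      _ = _ := one_mul _
  have hpos : 0 < ∑' n, (legendrePoly n).eval s * r ^ n := by
    by_contra! hneg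
    have h1 : ∑' n, (legendrePoly n).eval s * (0 : ℝ) ^ n = 1 := by
      rw [tsum_eq_single 0 fun n hn => by simp [hn]]
      simp [legendrePoly]
    obtain ⟨x, hx, hx0⟩ := intermediate_value_Icc' h0 hcont ⟨hneg, h1.symm ▸ zero_le_one⟩
    have := hsq hx
    simp only at hx0
    rw [hx0] at this
    norm_num at this
  have hQ : 0 < 1 - 2 * s * r + r ^ 2 := by nlinarith [sq_nonneg (r - s)]
  have h2 := hsq hrr
  have hval : ∑' n, (legendrePoly n).eval s * r ^ n = 1 / √(1 - 2 * s * r + r ^ 2) := by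
    rw [eq_div_iff (Real.sqrt_pos.2 hQ).ne', ← sq_eq_sq₀ (by positivity) zero_le_one, mul_pow,
      Real.sq_sqrt hQ.le]
    linarith
  rw [← hval]
  exact (summable_legendrePoly hs (habs hrr)).of_norm.hasSum

end Legendre

section Weight

open scoped ENNReal

theorem setLIntegral_eq_of_subset_of_eq_zero {α : Type*} [MeasurableSpace α] {μ : Measure α}
    {s t : Set α} {f : α → ℝ≥0∞} (hs : MeasurableSet s) (hst : s ⊆ t) (ht : MeasurableSet t)
    (h : ∀ x ∈ t \ s, f x = 0) : ∫⁻ x in t, f x ∂μ = ∫⁻ x in s, f x ∂μ := by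
  rw [← lintegral_inter_add_sdiff f t hs, Set.inter_eq_right.2 hst,
    setLIntegral_congr_fun (ht.diff hs) h]
  simp

theorem lintegral_div_sqrt_sq_sub_sq {y : ℝ} (hy : 0 < y) (g : ℝ → ℝ≥0∞) :
    ∫⁻ t in Set.Ioo 0 y, g t * ENNReal.ofReal (1 / √(y ^ 2 - t ^ 2)) =
      ∫⁻ v in Set.Ioo 0 (π / 2), g (y * sin v) := by
  have himg : (fun v => y * sin v) '' Set.Ioo 0 (π / 2) = Set.Ioo 0 y := by
    ext t
    constructor
    · rintro ⟨v, ⟨h0, h1⟩, rfl⟩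
      have hs : 0 < sin v := sin_pos_of_pos_of_lt_pi h0 (by linarith [pi_pos])
      have hs1 : sin v < 1 := by
        rw [← sin_pi_div_two]
        exact sin_lt_sin_of_lt_of_le_pi_div_two (by linarith [pi_pos]) le_rfl h1
      exact ⟨by positivity, by simpa using mul_lt_mul_of_pos_left hs1 hy⟩
    · rintro ⟨h0, h1⟩
      refine ⟨arcsin (t / y), ⟨arcsin_pos.2 (by positivity), arcsin_lt_pi_div_two.2 ?_⟩, ?_⟩
      · rwa [div_lt_one hy]
      · have : t / y ≤ 1 := by rw [div_le_one hy]; exact h1.le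
        beta_reduce
        rw [sin_arcsin (by linarith [div_pos h0 hy]) this]
        field_simp
  rw [← himg, lintegral_image_eq_lintegral_abs_deriv_mul measurableSet_Ioo
    (fun v _ => ((hasDerivAt_sin v).const_mul y).hasDerivWithinAt)]
  · refine setLIntegral_congr_fun measurableSet_Ioo fun v hv => ?_
    have hc : 0 < cos v := cos_pos_of_mem_Ioo ⟨by linarith [hv.1, pi_pos], hv.2⟩
    have h : y ^ 2 - (y * sin v) ^ 2 = (y * cos v) ^ 2 := by
      rw [mul_pow, mul_pow, cos_sq']
      ring
    rw [h, Real.sqrt_sq (by positivity), mul_left_comm, ← ENNReal.ofReal_mul (abs_nonneg _),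
      abs_of_pos (by positivity), mul_one_div_cancel (by positivity), ENNReal.ofReal_one, mul_one]
  · intro a ha b hb hab
    exact injOn_sin ⟨by linarith [ha.1, pi_pos], ha.2.le⟩ ⟨by linarith [hb.1, pi_pos], hb.2.le⟩
      (mul_left_cancel₀ hy.ne' hab)

theorem lintegral_elliptic_eq {t : ℝ} (h0 : 0 < t) (h1 : t < 1) :
    ∫⁻ φ in Set.Ioo 0 (π / 2), ENNReal.ofReal (1 / √(1 - (1 - t ^ 2) * sin φ ^ 2)) =
      ∫⁻ y in Set.Ioo t 1,
        ENNReal.ofReal (1 / √(y ^ 2 - t ^ 2)) * ENNReal.ofReal (1 / √(1 - y ^ 2)) := by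
  have ht : 0 < 1 - t ^ 2 := by nlinarith
  have hsin {φ : ℝ} (hφ : φ ∈ Set.Ioo 0 (π / 2)) : 0 < sin φ :=
    sin_pos_of_pos_of_lt_pi hφ.1 (by linarith [hφ.2, pi_pos])
  have hcos {φ : ℝ} (hφ : φ ∈ Set.Ioo 0 (π / 2)) : 0 < cos φ :=
    cos_pos_of_mem_Ioo ⟨by linarith [hφ.1, pi_pos], hφ.2⟩
  have hpos (φ : ℝ) : 0 < 1 - (1 - t ^ 2) * sin φ ^ 2 := by
    nlinarith [sin_sq_add_cos_sq φ, sq_nonneg (cos φ), sq_nonneg (sin φ)]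
  have himg : (fun φ => √(1 - (1 - t ^ 2) * sin φ ^ 2)) '' Set.Ioo 0 (π / 2) = Set.Ioo t 1 := by
    ext y
    constructor
    · rintro ⟨φ, hφ, rfl⟩
      have hs := hsin hφ
      have hc := hcos hφ
      constructor
      · rw [Real.lt_sqrt h0.le]
        nlinarith [sin_sq_add_cos_sq φ, mul_pos ht (pow_pos hc 2)]
      · rw [Real.sqrt_lt' one_pos]
        nlinarith [mul_pos ht (pow_pos hs 2)]
    · rintro ⟨hy0, hy1⟩
      have hy : 0 < 1 - y ^ 2 := by nlinarith
      have hq : (1 - y ^ 2) / (1 - t ^ 2) < 1 := by rw [div_lt_one ht]; nlinarith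
      have hq0 : 0 < (1 - y ^ 2) / (1 - t ^ 2) := by positivity
      have hq1 : √((1 - y ^ 2) / (1 - t ^ 2)) < 1 := by
        rw [Real.sqrt_lt' one_pos]; simpa using hq
      refine ⟨arcsin √((1 - y ^ 2) / (1 - t ^ 2)), ⟨arcsin_pos.2 (by positivity),
        arcsin_lt_pi_div_two.2 hq1⟩, ?_⟩
      beta_reduce
      rw [sin_arcsin (by linarith [Real.sqrt_nonneg ((1 - y ^ 2) / (1 - t ^ 2))]) hq1.le,
        Real.sq_sqrt hq0.le, mul_div_cancel₀ _ ht.ne', sub_sub_cancel,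
        Real.sqrt_sq (by linarith)]
  have hderiv (φ : ℝ) : HasDerivAt (fun φ => √(1 - (1 - t ^ 2) * sin φ ^ 2))
      (-((1 - t ^ 2) * sin φ * cos φ / √(1 - (1 - t ^ 2) * sin φ ^ 2))) φ := by
    have h := ((((hasDerivAt_sin φ).pow 2).const_mul (1 - t ^ 2)).const_sub 1).sqrt (hpos φ).ne'
    refine h.congr_deriv ?_
    have := Real.sqrt_pos.2 (hpos φ)
    push_cast
    simp only [Pi.pow_apply]
    field_simp
  rw [← himg, lintegral_image_eq_lintegral_abs_deriv_mul measurableSet_Ioo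
    (fun φ _ => (hderiv φ).hasDerivWithinAt)]
  · refine setLIntegral_congr_fun measurableSet_Ioo fun φ hφ => ?_
    have hs := hsin hφ
    have hc := hcos hφ
    have hf := Real.sqrt_pos.2 (hpos φ)
    rw [Real.sq_sqrt (hpos φ).le, ← ENNReal.ofReal_mul (by positivity),
      ← ENNReal.ofReal_mul (abs_nonneg _), abs_neg, abs_of_pos (by positivity)]
    congr 1
    have e1 : 1 - (1 - t ^ 2) * sin φ ^ 2 - t ^ 2 = (1 - t ^ 2) * cos φ ^ 2 := by
      rw [cos_sq']; ring
    rw [e1, sub_sub_cancel, Real.sqrt_mul ht.le, Real.sqrt_mul ht.le, Real.sqrt_sq hs.le,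
      Real.sqrt_sq hc.le]
    have hr := Real.sqrt_pos.2 ht
    have hr2 := Real.sq_sqrt ht.le
    field_simp
    linarith
  · intro a ha b hb hab
    simp only at hab
    rw [Real.sqrt_inj (hpos a).le (hpos b).le] at hab
    have h2 : sin a ^ 2 = sin b ^ 2 := mul_left_cancel₀ ht.ne' (by linarith)
    exact injOn_sin ⟨by linarith [ha.1, pi_pos], ha.2.le⟩ ⟨by linarith [hb.1, pi_pos], hb.2.le⟩
      ((sq_eq_sq₀ (hsin ha).le (hsin hb).le).1 h2)

/-- The complementary elliptic integral, `K(√(1 - t²))` as a function of `t`. -/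
noncomputable def complK (t : ℝ) : ℝ := K √(1 - t ^ 2)

theorem complK_neg (t : ℝ) : complK (-t) = complK t := by simp [complK]

theorem complK_nonneg (t : ℝ) : 0 ≤ complK t :=
  setIntegral_nonneg measurableSet_Ioo fun _ _ => by positivity

theorem measurable_complK : Measurable complK := by
  have h : StronglyMeasurable fun p : ℝ × ℝ => 1 / √(1 - √(1 - p.1 ^ 2) ^ 2 * sin p.2 ^ 2) := by
    refine Measurable.stronglyMeasurable ?_
    fun_prop
  exact (h.integral_prod_right' (ν := volume.restrict (Set.Ioo 0 (π / 2)))).measurable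

theorem one_sub_mul_sin_sq_ge {t : ℝ} (h1 : t ^ 2 ≤ 1) (φ : ℝ) :
    t ^ 2 ≤ 1 - (1 - t ^ 2) * sin φ ^ 2 := by
  nlinarith [sin_sq_add_cos_sq φ, mul_nonneg (sub_nonneg.2 h1) (sq_nonneg (cos φ))]

theorem complK_eq {t : ℝ} (h1 : t ^ 2 ≤ 1) :
    complK t = ∫ φ in Set.Ioo 0 (π / 2), 1 / √(1 - (1 - t ^ 2) * sin φ ^ 2) := by
  rw [complK, K, Real.sq_sqrt (by linarith)]

theorem complK_le {t : ℝ} (h0 : 1 / 2 ≤ t) (h1 : t ≤ 1) : complK t ≤ π := by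
  have h : t ^ 2 ≤ 1 := by nlinarith
  rw [complK_eq h]
  refine (le_abs_self _).trans ?_
  have := norm_setIntegral_le_of_norm_le_const (μ := volume) (s := Set.Ioo 0 (π / 2)) (C := 2)
    (f := fun φ => 1 / √(1 - (1 - t ^ 2) * sin φ ^ 2)) (by simp) (fun φ _ => by
      rw [Real.norm_of_nonneg (by positivity)]
      have h2 : 1 / 2 ≤ √(1 - (1 - t ^ 2) * sin φ ^ 2) := by
        refine Real.le_sqrt_of_sq_le ?_
        have := one_sub_mul_sin_sq_ge h φ
        nlinarith
      rw [div_le_iff₀ (by linarith)]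
      linarith)
  refine this.trans ?_
  rw [measureReal_def, Real.volume_Ioo, ENNReal.toReal_ofReal (by linarith [pi_pos])]
  linarith

theorem ofReal_complK {t : ℝ} (h0 : 0 < t) (h1 : t < 1) :
    ENNReal.ofReal (complK t) =
      ∫⁻ φ in Set.Ioo 0 (π / 2), ENNReal.ofReal (1 / √(1 - (1 - t ^ 2) * sin φ ^ 2)) := by
  have ht : t ^ 2 ≤ 1 := by nlinarith
  rw [complK_eq ht]
  refine ofReal_integral_eq_lintegral_ofReal ?_ (Eventually.of_forall fun φ => by positivity)
  refine IntegrableOn.mono_set (ContinuousOn.integrableOn_Icc ?_) Set.Ioo_subset_Icc_self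
  refine ContinuousOn.div continuousOn_const (by fun_prop) fun φ _ => ?_
  exact (Real.sqrt_pos.2 (lt_of_lt_of_le (by positivity) (one_sub_mul_sin_sq_ge ht φ))).ne'

theorem lintegral_mul_complK {g : ℝ → ℝ≥0∞} (hg : Measurable g) :
    ∫⁻ t in Set.Ioo 0 1, g t * ENNReal.ofReal (complK t) =
      ∫⁻ u in Set.Ioo 0 (π / 2), ∫⁻ v in Set.Ioo 0 (π / 2), g (sin u * sin v) := by
  have hzero {t y : ℝ} (h0 : 0 < y) (h : y ≤ t) : ENNReal.ofReal (1 / √(y ^ 2 - t ^ 2)) = 0 := by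
    rw [Real.sqrt_eq_zero_of_nonpos (by nlinarith)]
    simp
  calc _ = ∫⁻ t in Set.Ioo 0 1, ∫⁻ y in Set.Ioo 0 1, g t *
        (ENNReal.ofReal (1 / √(y ^ 2 - t ^ 2)) * ENNReal.ofReal (1 / √(1 - y ^ 2))) := by
        refine setLIntegral_congr_fun measurableSet_Ioo fun t ht => ?_
        rw [ofReal_complK ht.1 ht.2, lintegral_elliptic_eq ht.1 ht.2,
          lintegral_const_mul _ (by fun_prop)]
        congr 1
        refine (setLIntegral_eq_of_subset_of_eq_zero measurableSet_Ioo
          (Set.Ioo_subset_Ioo_left ht.1.le) measurableSet_Ioo fun y hy => ?_).symm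
        rw [hzero hy.1.1 (by by_contra! h; exact hy.2 ⟨h, hy.1.2⟩), zero_mul]
    _ = ∫⁻ y in Set.Ioo 0 1, ∫⁻ t in Set.Ioo 0 1, g t *
        (ENNReal.ofReal (1 / √(y ^ 2 - t ^ 2)) * ENNReal.ofReal (1 / √(1 - y ^ 2))) :=
        lintegral_lintegral_swap (by fun_prop)
    _ = ∫⁻ y in Set.Ioo 0 1, (∫⁻ v in Set.Ioo 0 (π / 2), g (y * sin v)) *
          ENNReal.ofReal (1 / √(1 ^ 2 - y ^ 2)) := by
        refine setLIntegral_congr_fun measurableSet_Ioo fun y hy => ?_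
        rw [one_pow, ← lintegral_div_sqrt_sq_sub_sq hy.1, ← lintegral_mul_const _ (by fun_prop)]
        simp_rw [mul_assoc]
        refine setLIntegral_eq_of_subset_of_eq_zero measurableSet_Ioo
          (Set.Ioo_subset_Ioo_right hy.2.le) measurableSet_Ioo fun t ht => ?_
        rw [hzero hy.1 (by by_contra! h; exact ht.2 ⟨ht.1.1, h⟩), zero_mul, mul_zero]
    _ = _ := by
        rw [lintegral_div_sqrt_sq_sub_sq one_pos]
        simp only [one_mul]

theorem lintegral_pow_mul_complK (n : ℕ) :
    ∫⁻ t in Set.Ioo 0 1, ENNReal.ofReal (t ^ n * complK t) =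
      ENNReal.ofReal ((∫ u in (0 : ℝ)..π / 2, sin u ^ n) ^ 2) := by
  have hsin : ∫⁻ u in Set.Ioo 0 (π / 2), ENNReal.ofReal (sin u ^ n) =
      ENNReal.ofReal (∫ u in (0 : ℝ)..π / 2, sin u ^ n) := by
    rw [intervalIntegral.integral_of_le (by positivity), integral_Ioc_eq_integral_Ioo]
    refine (ofReal_integral_eq_lintegral_ofReal ?_ ?_).symm
    · exact IntegrableOn.mono_set (Continuous.integrableOn_Icc (by fun_prop))
        Set.Ioo_subset_Icc_self
    · filter_upwards [ae_restrict_mem measurableSet_Ioo] with u hu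
      exact pow_nonneg (sin_pos_of_pos_of_lt_pi hu.1 (by linarith [hu.2, pi_pos])).le n
  have h : ∫⁻ t in Set.Ioo 0 1, ENNReal.ofReal (t ^ n * complK t) =
      ∫⁻ t in Set.Ioo 0 1, ENNReal.ofReal (t ^ n) * ENNReal.ofReal (complK t) :=
    setLIntegral_congr_fun measurableSet_Ioo fun t ht =>
      ENNReal.ofReal_mul (pow_nonneg ht.1.le n)
  rw [h, lintegral_mul_complK (g := fun t => ENNReal.ofReal (t ^ n)) (by fun_prop), pow_two,
    ENNReal.ofReal_mul', ← hsin, ← lintegral_mul_const _ (by fun_prop)]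
  · refine setLIntegral_congr_fun measurableSet_Ioo fun u hu => ?_
    rw [← lintegral_const_mul _ (by fun_prop)]
    refine setLIntegral_congr_fun measurableSet_Ioo fun v hv => ?_
    rw [mul_pow, ENNReal.ofReal_mul]
    exact pow_nonneg (sin_pos_of_pos_of_lt_pi hu.1 (by linarith [hu.2, pi_pos])).le n
  · refine intervalIntegral.integral_nonneg (by positivity) fun u hu => ?_
    exact pow_nonneg (sin_nonneg_of_nonneg_of_le_pi hu.1 (by linarith [hu.2, pi_pos])) n

theorem integrableOn_pow_mul_complK (n : ℕ) :
    IntegrableOn (fun t => t ^ n * complK t) (Set.Ioo 0 1) := by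
  have := measurable_complK
  refine ⟨by fun_prop, ?_⟩
  rw [hasFiniteIntegral_iff_ofReal, lintegral_pow_mul_complK]
  · exact ENNReal.ofReal_lt_top
  · filter_upwards [ae_restrict_mem measurableSet_Ioo] with t ht
    exact mul_nonneg (pow_nonneg ht.1.le n) (complK_nonneg t)

theorem integral_pow_mul_complK (n : ℕ) :
    ∫ t in (0 : ℝ)..1, t ^ n * complK t = (∫ u in (0 : ℝ)..π / 2, sin u ^ n) ^ 2 := by
  rw [intervalIntegral.integral_of_le zero_le_one, integral_Ioc_eq_integral_Ioo,
    integral_eq_lintegral_of_nonneg_ae, lintegral_pow_mul_complK,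
    ENNReal.toReal_ofReal (sq_nonneg _)]
  · filter_upwards [ae_restrict_mem measurableSet_Ioo] with t ht
    exact mul_nonneg (pow_nonneg ht.1.le n) (complK_nonneg t)
  · exact (integrableOn_pow_mul_complK n).1

theorem integral_sin_pow_half (n : ℕ) :
    ((n : ℝ) + 2) * ∫ u in (0 : ℝ)..π / 2, sin u ^ (n + 2) =
      ((n : ℝ) + 1) * ∫ u in (0 : ℝ)..π / 2, sin u ^ n := by
  rw [integral_sin_pow]
  simp
  field_simp

theorem intervalIntegrable_complK : IntervalIntegrable complK volume (-1) 1 := by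
  have h1 : IntervalIntegrable complK volume 0 1 := by
    rw [intervalIntegrable_iff_integrableOn_Ioo_of_le zero_le_one]
    simpa using integrableOn_pow_mul_complK 0
  have h2 : IntervalIntegrable complK volume (-1) 0 := by
    simpa [complK_neg] using (h1.comp_sub_left 0).symm
  exact h2.trans h1

theorem intervalIntegrable_continuous_mul_complK {f : ℝ → ℝ} (hf : Continuous f) :
    IntervalIntegrable (fun t => f t * complK t) volume (-1) 1 :=
  intervalIntegrable_complK.continuousOn_mul hf.continuousOn

/-- Integration of polynomials against `complK` over `[-1, 1]`. -/
noncomputable def complKMoment : Polynomial ℝ →ₗ[ℝ] ℝ where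
  toFun f := ∫ t in (-1 : ℝ)..1, f.eval t * complK t
  map_add' f g := by
    rw [← intervalIntegral.integral_add
      (intervalIntegrable_continuous_mul_complK f.continuous)
      (intervalIntegrable_continuous_mul_complK g.continuous)]
    simp [add_mul]
  map_smul' c f := by
    simp [← intervalIntegral.integral_const_mul, mul_assoc]

theorem complKMoment_X_pow (n : ℕ) :
    complKMoment (Polynomial.X ^ n) =
      ((-1) ^ n + 1) * (∫ u in (0 : ℝ)..π / 2, sin u ^ n) ^ 2 := by
  have h := intervalIntegrable_continuous_mul_complK (f := fun t => t ^ n) (by fun_prop)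
  have h1 : IntervalIntegrable (fun t => t ^ n * complK t) volume (-1) 0 :=
    h.mono_set (by
      rw [Set.uIcc_of_le (by norm_num), Set.uIcc_of_le (by norm_num)]
      exact Set.Icc_subset_Icc_right zero_le_one)
  have h2 : IntervalIntegrable (fun t => t ^ n * complK t) volume 0 1 :=
    h.mono_set (by
      rw [Set.uIcc_of_le (by norm_num), Set.uIcc_of_le (by norm_num)]
      exact Set.Icc_subset_Icc_left (by norm_num))
  have h3 : ∫ t in (-1 : ℝ)..0, t ^ n * complK t = (-1) ^ n * ∫ t in (0 : ℝ)..1, t ^ n * complK t := by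
    rw [← intervalIntegral.integral_const_mul, ← neg_zero (G := ℝ),
      ← intervalIntegral.integral_comp_neg, neg_zero]
    refine intervalIntegral.integral_congr fun t _ => ?_
    rw [complK_neg, neg_pow]
    ring
  change ∫ t in (-1 : ℝ)..1, (Polynomial.X ^ n : Polynomial ℝ).eval t * complK t = _
  simp only [Polynomial.eval_pow, Polynomial.eval_X]
  rw [← intervalIntegral.integral_add_adjacent_intervals h1 h2, h3, integral_pow_mul_complK]
  ring

theorem complKMoment_X : complKMoment Polynomial.X = 0 := by
  simpa using complKMoment_X_pow 1

theorem complKMoment_one : complKMoment 1 = π ^ 2 / 2 := by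
  have := complKMoment_X_pow 0
  simp only [pow_zero, intervalIntegral.integral_const, smul_eq_mul] at this
  rw [this]
  ring

theorem complKMoment_recursion (n : ℕ) :
    ((n : ℝ) + 2) ^ 2 * complKMoment (Polynomial.X ^ (n + 2)) =
      ((n : ℝ) + 1) ^ 2 * complKMoment (Polynomial.X ^ n) := by
  have h := congrArg (· ^ 2) (integral_sin_pow_half n)
  simp only [mul_pow] at h
  rw [complKMoment_X_pow, complKMoment_X_pow, pow_add (-1 : ℝ)]
  linear_combination ((-1) ^ n + 1) * h

end Weight

theorem complKMoment_apply (f : Polynomial ℝ) :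
    complKMoment f = ∫ t in (-1 : ℝ)..1, f.eval t * complK t := rfl

theorem hasSum_complKMoment_legendrePoly {r : ℝ} (h0 : 0 ≤ r) (hr : r < 1) :
    HasSum (fun n => r ^ n * complKMoment (legendrePoly n))
      (∫ t in (-1 : ℝ)..1, 1 / √(1 - 2 * t * r + r ^ 2) * complK t) := by
  have hK := measurable_complK
  have hmem : ∀ᵐ t : ℝ, t ∈ Set.uIoc (-1 : ℝ) 1 → t ^ 2 < 1 := by
    filter_upwards [Measure.ae_ne volume (1 : ℝ)] with t ht h
    rw [Set.uIoc_of_le (by norm_num)] at h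
    have := lt_of_le_of_ne h.2 ht
    nlinarith [h.1]
  have h := intervalIntegral.hasSum_integral_of_dominated_convergence (μ := volume)
    (a := (-1 : ℝ)) (b := 1)
    (F := fun n t => r ^ n * ((legendrePoly n).eval t * complK t))
    (f := fun t => 1 / √(1 - 2 * t * r + r ^ 2) * complK t)
    (fun n t => r ^ n * complK t) (fun n => ?_) (fun n => ?_) ?_ ?_ ?_
  · simpa only [intervalIntegral.integral_const_mul, ← complKMoment_apply] using h
  · have := (legendrePoly n).continuous.measurable
    fun_prop
  · filter_upwards [hmem] with t ht h
    rw [norm_mul, norm_mul, Real.norm_of_nonneg (pow_nonneg h0 n),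
      Real.norm_of_nonneg (complK_nonneg t)]
    refine mul_le_mul_of_nonneg_left ?_ (pow_nonneg h0 n)
    exact mul_le_of_le_one_left (complK_nonneg t) (abs_legendrePoly_le (ht h) n)
  · exact Eventually.of_forall fun t _ => (summable_geometric_of_lt_one h0 hr).mul_right _
  · simp only [tsum_mul_right]
    exact intervalIntegrable_complK.const_mul _
  · filter_upwards [hmem] with t ht h
    refine ((legendre_generating (ht h) h0 hr).mul_right (complK t)).congr_fun ?_
    intro n
    ring

theorem integral_complK_div_sqrt_of_lt {r : ℝ} (h0 : 0 ≤ r) (hr : r < 1) :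
    ∫ t in (-1 : ℝ)..1, 1 / √(1 - 2 * t * r + r ^ 2) * complK t =
      π ^ 2 / 2 * ∑' n, halfCoeff n ^ 3 * (-r ^ 2) ^ n := by
  have h := hasSum_complKMoment_legendrePoly h0 hr
  rw [← (mul_right_injective₀ (two_ne_zero' ℕ)).hasSum_iff] at h
  · rw [← h.tsum_eq, ← tsum_mul_left]
    refine tsum_congr fun n => ?_
    simp only [Function.comp_apply]
    rw [map_legendrePoly_even complKMoment_X complKMoment_recursion, complKMoment_one, neg_pow,
      pow_mul]
    ring
  · intro n hn
    obtain ⟨k, rfl | rfl⟩ := n.even_or_odd'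
    · exact absurd ⟨k, rfl⟩ hn
    · rw [map_legendrePoly_odd complKMoment_X complKMoment_recursion, mul_zero]

theorem intervalIntegrable_complK_div_sqrt_one_sub :
    IntervalIntegrable (fun t => √2 * complK t + π * (1 - t) ^ (-(1 / 2) : ℝ)) volume (-1) 1 := by
  refine (intervalIntegrable_complK.const_mul _).add (IntervalIntegrable.const_mul ?_ _)
  have := (intervalIntegral.intervalIntegrable_rpow' (a := 0) (b := 2) (r := -(1 / 2))
    (by norm_num)).comp_sub_left 1
  norm_num at this ⊢
  exact this.symm

theorem complK_div_sqrt_le {r t : ℝ} (hr0 : 1 / 2 ≤ r) (ht1 : t < 1) :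
    1 / √(1 - 2 * t * r + r ^ 2) * complK t ≤
      √2 * complK t + π * (1 - t) ^ (-(1 / 2) : ℝ) := by
  have hK := complK_nonneg t
  have ht : 0 < 1 - t := by linarith
  have hp : 0 ≤ π * (1 - t) ^ (-(1 / 2) : ℝ) := by positivity
  have hle : 1 - t ≤ 1 - 2 * t * r + r ^ 2 := by
    nlinarith [mul_nonneg (sub_nonneg.2 hr0) ht.le, sq_nonneg (1 - r)]
  have h1 : 1 / √(1 - 2 * t * r + r ^ 2) ≤ 1 / √(1 - t) :=
    one_div_le_one_div_of_le (Real.sqrt_pos.2 ht) (Real.sqrt_le_sqrt hle)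
  refine (mul_le_mul_of_nonneg_right h1 hK).trans ?_
  rcases le_total t (1 / 2) with h | h
  · refine le_add_of_le_of_nonneg (mul_le_mul_of_nonneg_right ?_ hK) hp
    rw [one_div, ← Real.sqrt_inv]
    refine Real.sqrt_le_sqrt ?_
    rw [inv_le_comm₀ ht two_pos]
    linarith
  · refine le_add_of_nonneg_of_le (by positivity) ?_
    rw [Real.rpow_neg ht.le, ← Real.sqrt_eq_rpow, ← one_div, mul_comm]
    exact mul_le_mul_of_nonneg_right (complK_le h ht1.le) (by positivity)

theorem tendsto_integral_complK_div_sqrt :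
    Tendsto (fun r : ℝ => ∫ t in (-1 : ℝ)..1, 1 / √(1 - 2 * t * r + r ^ 2) * complK t)
      (nhdsWithin 1 (Set.Iio 1))
      (nhds (∫ t in (-1 : ℝ)..1, 1 / √(1 - 2 * t * 1 + 1 ^ 2) * complK t)) := by
  have hK := measurable_complK
  have hmem : ∀ᶠ r : ℝ in nhdsWithin 1 (Set.Iio 1), 1 / 2 ≤ r :=
    mem_of_superset (Ioo_mem_nhdsLT (by norm_num : (1 / 2 : ℝ) < 1)) fun r hr => hr.1.le
  refine intervalIntegral.tendsto_integral_filter_of_dominated_convergence _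
    (Eventually.of_forall fun r => ?_) ?_ intervalIntegrable_complK_div_sqrt_one_sub ?_
  · exact Measurable.aestronglyMeasurable (by fun_prop)
  · filter_upwards [hmem] with r hr
    filter_upwards [Measure.ae_ne volume (1 : ℝ)] with t ht h
    rw [Set.uIoc_of_le (by norm_num)] at h
    rw [Real.norm_of_nonneg (mul_nonneg (by positivity) (complK_nonneg t))]
    exact complK_div_sqrt_le hr (lt_of_le_of_ne h.2 ht)
  · filter_upwards [Measure.ae_ne volume (1 : ℝ)] with t ht h
    rw [Set.uIoc_of_le (by norm_num)] at h
    have ht1 := lt_of_le_of_ne h.2 ht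
    have hne : √(1 - 2 * t * 1 + 1 ^ 2) ≠ 0 := (Real.sqrt_pos.2 (by linarith)).ne'
    have hc : ContinuousAt (fun r : ℝ => 1 / √(1 - 2 * t * r + r ^ 2) * complK t) 1 :=
      (continuousAt_const.div (g := fun r => √(1 - 2 * t * r + r ^ 2))
        (Continuous.continuousAt (by fun_prop)) hne).mul continuousAt_const
    exact hc.tendsto.mono_left nhdsWithin_le_nhds

theorem integral_complK_div_sqrt {r : ℝ} (h0 : 0 ≤ r) (hr : r ≤ 1) :
    ∫ t in (-1 : ℝ)..1, 1 / √(1 - 2 * t * r + r ^ 2) * complK t =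
      π ^ 2 / 2 * ∑' n, halfCoeff n ^ 3 * (-r ^ 2) ^ n := by
  rcases hr.lt_or_eq with hr | rfl
  · exact integral_complK_div_sqrt_of_lt h0 hr
  have hcont : ContinuousOn (fun r : ℝ => π ^ 2 / 2 * ∑' n, halfCoeff n ^ 3 * (-r ^ 2) ^ n)
      (Set.Icc 0 1) := by
    refine continuousOn_const.mul (continuousOn_tsum (fun n => by fun_prop)
      summable_halfCoeff_cube fun n x hx => ?_)
    rw [norm_mul, norm_pow (-x ^ 2), norm_neg, Real.norm_of_nonneg (sq_nonneg x),
      Real.norm_of_nonneg (pow_nonneg (halfCoeff_pos n).le 3)]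
    refine mul_le_of_le_one_right (pow_nonneg (halfCoeff_pos n).le 3) ?_
    exact pow_le_one₀ (sq_nonneg x) (pow_le_one₀ hx.1 hx.2)
  have hlim := (hcont 1 ⟨zero_le_one, le_rfl⟩).mono_left (nhdsWithin_mono 1 Set.Ioo_subset_Icc_self)
  rw [nhdsWithin_Ioo_eq_nhdsLT zero_lt_one] at hlim
  refine tendsto_nhds_unique (tendsto_integral_complK_div_sqrt.congr' ?_) hlim
  filter_upwards [Ioo_mem_nhdsLT (zero_lt_one' ℝ)] with r hr
  exact integral_complK_div_sqrt_of_lt hr.1.le hr.2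

theorem stmt4 (a : ℝ) (ha : 1 ≤ a) :
    ∫ x in (0:ℝ)..1, K (2 * Real.sqrt (x * (1 - x))) /
        Real.sqrt (1 - 2 * (2 * x - 1) * a + a ^ 2) =
      (1 / a) * Ksq ((1 - Real.sqrt (1 + 1 / a ^ 2)) / 2) ^ 2 := by
  have ha0 : 0 < a := by linarith
  have hK (x : ℝ) : K (2 * √(x * (1 - x))) = complK (2 * x - 1) := by
    rw [complK, show 1 - (2 * x - 1) ^ 2 = 2 ^ 2 * (x * (1 - x)) by ring,
      Real.sqrt_mul (sq_nonneg 2), Real.sqrt_sq zero_le_two]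
  have hS (t : ℝ) : √(1 - 2 * t * a + a ^ 2) = a * √(1 - 2 * t * (1 / a) + (1 / a) ^ 2) := by
    rw [← Real.sqrt_sq ha0.le, ← Real.sqrt_mul (sq_nonneg a), Real.sqrt_sq ha0.le]
    congr 1
    field_simp
    ring
  have hr : (1 / a) ≤ 1 := by rwa [div_le_one ha0]
  have hr2 : (1 / a) ^ 2 ≤ 1 := pow_le_one₀ (by positivity) hr
  have hsub := intervalIntegral.integral_comp_mul_sub (a := 0) (b := 1)
    (fun t => 1 / a * (1 / √(1 - 2 * t * (1 / a) + (1 / a) ^ 2) * complK t))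
    (two_ne_zero' ℝ) 1
  have hcongr : ∫ x in (0 : ℝ)..1, K (2 * √(x * (1 - x))) / √(1 - 2 * (2 * x - 1) * a + a ^ 2) =
      ∫ x in (0 : ℝ)..1,
        1 / a * (1 / √(1 - 2 * (2 * x - 1) * (1 / a) + (1 / a) ^ 2) * complK (2 * x - 1)) := by
    refine intervalIntegral.integral_congr fun x _ => ?_
    rw [hK, hS]
    simp only [div_eq_mul_inv, mul_inv]
    ring
  rw [hcongr, hsub, intervalIntegral.integral_const_mul, mul_zero, zero_sub, mul_one,
    show (2 : ℝ) - 1 = 1 by norm_num, integral_complK_div_sqrt (by positivity) hr,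
    ← one_div_pow, Ksq_sq_eq_tsum hr2, smul_eq_mul]
  ring
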